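/- Let α be a twisted partial action of a groupoid 𝒢 on a ring R with each D_g unital, and let β = ({E_g}, {β_g}, {u_{g,h}}) be a globalization of α acting on a ring T. Assume 𝒢₀ is finite, set A = R ⋊_{α,w} 𝒢 and B = T ⋊_{β,u} 𝒢, and identify each φ_e(D_e) with D_e, so that A is unital with identity 1_A = Σ_{e∈𝒢₀} 1_e δ_e. Then: (i) B·1_A = { Σ_{g∈𝒢}^{finite} c_g δ_g : c_g ∈ β_g(D_{d(g)}) }; (ii) 1_A·B = { Σ_{g∈𝒢}^{finite} c_g δ_g : c_g ∈ D_{r(g)} }; (iii) 1_A·B·1_A = A; (iv) B·1_A·B = B. -/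

import Mathlib

attribute [local instance] Classical.propDecidable

universe u v w

/-- An (algebraic) groupoid: a set with a partially defined associative binary
operation in which every element `g` has a left identity `tgt g` (= `r(g)`),
a right identity `src g` (= `d(g)`) and an inverse `inv g`, a product `mul g h`
being defined precisely when `comp g h`, i.e. `src g = tgt h`. -/
structure PGroupoid (G : Type u) where
  mul : G → G → G
  inv : G → G
  src : G → G
  tgt : G → G
  comp : G → G → Prop
  comp_iff : ∀ g h, comp g h ↔ src g = tgt h
  mul_assoc' : ∀ g h k, comp g h → comp h k → mul (mul g h) k = mul g (mul h k)
  src_mul : ∀ g h, comp g h → src (mul g h) = src h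
  tgt_mul : ∀ g h, comp g h → tgt (mul g h) = tgt g
  comp_inv_left : ∀ g, comp (inv g) g
  comp_inv_right : ∀ g, comp g (inv g)
  inv_mul_self : ∀ g, mul (inv g) g = src g
  mul_inv_self : ∀ g, mul g (inv g) = tgt g
  src_inv : ∀ g, src (inv g) = tgt g
  tgt_inv : ∀ g, tgt (inv g) = src g
  tgt_mul_self : ∀ g, mul (tgt g) g = g
  mul_src_self : ∀ g, mul g (src g) = g
  comp_tgt_self : ∀ g, comp (tgt g) g
  comp_src_self : ∀ g, comp g (src g)
  inv_inv : ∀ g, inv (inv g) = g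
  inv_mul_rev : ∀ g h, comp g h → inv (mul g h) = mul (inv h) (inv g)

/-- The identities of the groupoid. -/
def PGroupoid.isId {G : Type u} (gd : PGroupoid G) (e : G) : Prop := gd.tgt e = e

/-- The additive subgroup generated by products `x * y` with `x ∈ X`, `y ∈ Y`,
i.e. the product `X · Y` of two ideals. -/
def setMulAdd {R : Type v} [NonUnitalRing R] (X Y : Set R) : AddSubgroup R :=
  AddSubgroup.closure {r | ∃ x ∈ X, ∃ y ∈ Y, r = x * y}

/-- A twisted partial action of a groupoid on a (non-necessarily unital) ring `R`:
ideals `D g` (each `D (tgt g)` an ideal of `R`, and `D g` an ideal of `D (tgt g)`),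
ring isomorphisms `act g : D (inv g) → D g` (with inverse `actinv g`), and invertible
multipliers `w g h` of `D g · D (gh)` (represented by elements acting by left/right
multiplication, with inverse multiplier `winv g h`), subject to axioms (i)-(vi). -/
structure RingTPA {G : Type u} (gd : PGroupoid G) (R : Type v) [NonUnitalRing R] where
  D : G → AddSubgroup R
  act : G → R → R
  actinv : G → R → R
  w : G → G → R
  winv : G → G → R
  ideal_top : ∀ (g : G) (r : R), ∀ x ∈ D (gd.tgt g),
      r * x ∈ D (gd.tgt g) ∧ x * r ∈ D (gd.tgt g)
  sub : ∀ g, D g ≤ D (gd.tgt g)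
  ideal_in : ∀ g, ∀ a ∈ D (gd.tgt g), ∀ x ∈ D g, a * x ∈ D g ∧ x * a ∈ D g
  act_bij : ∀ g, Set.BijOn (act g) ((D (gd.inv g) : Set R)) ((D g : Set R))
  act_add : ∀ g, ∀ a ∈ D (gd.inv g), ∀ b ∈ D (gd.inv g), act g (a + b) = act g a + act g b
  act_mul : ∀ g, ∀ a ∈ D (gd.inv g), ∀ b ∈ D (gd.inv g), act g (a * b) = act g a * act g b
  actinv_mem : ∀ g, ∀ a ∈ D g, actinv g a ∈ D (gd.inv g)
  act_actinv : ∀ g, ∀ a ∈ D g, act g (actinv g a) = a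
  actinv_act : ∀ g, ∀ a ∈ D (gd.inv g), actinv g (act g a) = a
  -- (i)
  sq : ∀ g, setMulAdd ((D g : Set R)) ((D g : Set R)) = D g
  comm : ∀ g h, setMulAdd ((D g : Set R)) ((D h : Set R)) = setMulAdd ((D h : Set R)) ((D g : Set R))
  -- (ii)
  id_eq : ∀ e, gd.isId e → D e = D (gd.tgt e)
  act_id : ∀ e, gd.isId e → ∀ a ∈ D e, act e a = a
  -- (iii)
  act_ideal : ∀ g h, gd.comp g h →
      act g '' ((setMulAdd ((D (gd.inv g) : Set R)) ((D h : Set R)) : AddSubgroup R) : Set R) =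
        ((setMulAdd ((D g : Set R)) ((D (gd.mul g h) : Set R)) : AddSubgroup R) : Set R)
  -- `w g h` is an invertible multiplier of `D g · D (gh)`
  w_mul_mem : ∀ g h, gd.comp g h → ∀ x ∈ setMulAdd ((D g : Set R)) ((D (gd.mul g h) : Set R)),
      w g h * x ∈ setMulAdd ((D g : Set R)) ((D (gd.mul g h) : Set R)) ∧
      x * w g h ∈ setMulAdd ((D g : Set R)) ((D (gd.mul g h) : Set R))
  winv_mul_mem : ∀ g h, gd.comp g h → ∀ x ∈ setMulAdd ((D g : Set R)) ((D (gd.mul g h) : Set R)),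
      winv g h * x ∈ setMulAdd ((D g : Set R)) ((D (gd.mul g h) : Set R)) ∧
      x * winv g h ∈ setMulAdd ((D g : Set R)) ((D (gd.mul g h) : Set R))
  w_winv : ∀ g h, gd.comp g h → ∀ x ∈ setMulAdd ((D g : Set R)) ((D (gd.mul g h) : Set R)),
      w g h * (winv g h * x) = x ∧ winv g h * (w g h * x) = x ∧
      (x * w g h) * winv g h = x ∧ (x * winv g h) * w g h = x
  -- (iv)
  act_act : ∀ g h, gd.comp g h →
      ∀ a ∈ setMulAdd ((D (gd.inv h) : Set R)) ((D (gd.mul (gd.inv h) (gd.inv g)) : Set R)),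
      act g (act h a) = w g h * act (gd.mul g h) a * winv g h
  -- (v)
  w_id_left : ∀ g, ∀ x ∈ D g, w (gd.tgt g) g * x = x ∧ x * w (gd.tgt g) g = x
  w_id_right : ∀ g, ∀ x ∈ D g, w g (gd.src g) * x = x ∧ x * w g (gd.src g) = x
  -- (vi)
  w_cocycle : ∀ g h t, gd.comp g h → gd.comp h t →
      ∀ a ∈ setMulAdd
          ((setMulAdd ((D (gd.inv g) : Set R)) ((D h : Set R)) : AddSubgroup R) : Set R)
          ((D (gd.mul h t) : Set R)),
      act g (a * w h t) * w g (gd.mul h t) = act g a * w g h * w (gd.mul g h) t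

/-- The multiplication of the twisted crossed product `R ⋊_{α,w} 𝒢`, realized on
finitely supported functions `G →₀ R`:
`(a δ_g)(b δ_h) = α_g(α_g⁻¹(a) b) w_{g,h} δ_{gh}` when `(g,h)` is composable, `0` otherwise. -/
noncomputable def cpMul {G : Type u} {R : Type v} [NonUnitalRing R] (gd : PGroupoid G)
    (A : RingTPA gd R) (f f' : G →₀ R) : G →₀ R :=
  f.sum fun g a => f'.sum fun h b =>
    if gd.comp g h then Finsupp.single (gd.mul g h) (A.act g (A.actinv g a * b) * A.w g h) else 0

namespace PGroupoid

variable {G : Type u} (gd : PGroupoid G)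

theorem tgt_tgt (g : G) : gd.tgt (gd.tgt g) = gd.tgt g := by
  simpa [gd.mul_inv_self] using gd.tgt_mul g (gd.inv g) (gd.comp_inv_right g)

theorem src_tgt (g : G) : gd.src (gd.tgt g) = gd.tgt g := by
  simpa [gd.mul_inv_self, gd.src_inv] using gd.src_mul g (gd.inv g) (gd.comp_inv_right g)

theorem tgt_src (g : G) : gd.tgt (gd.src g) = gd.src g := by
  simpa [gd.inv_mul_self, gd.tgt_inv] using gd.tgt_mul (gd.inv g) g (gd.comp_inv_left g)

theorem src_eq_of_isId {e : G} (he : gd.isId e) : gd.src e = e := by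
  have h := gd.src_tgt e
  rwa [he] at h

theorem mul_inv_mul_cancel {g h : G} (hgh : gd.tgt h = gd.tgt g) :
    gd.mul h (gd.mul (gd.inv h) g) = g := by
  have hc : gd.comp (gd.inv h) g := (gd.comp_iff _ _).2 (by rw [gd.src_inv, hgh])
  rw [← gd.mul_assoc' _ _ _ (gd.comp_inv_right h) hc, gd.mul_inv_self, hgh, gd.tgt_mul_self]

end PGroupoid

namespace RingTPA

variable {G : Type u} {T : Type v} [NonUnitalRing T] {gd : PGroupoid G} (B : RingTPA gd T)

theorem act_mem (g : G) {a : T} (ha : a ∈ B.D (gd.inv g)) : B.act g a ∈ B.D g :=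
  (B.act_bij g).mapsTo ha

theorem act_zero (g : G) : B.act g 0 = 0 := by
  simpa using B.act_add g 0 (zero_mem _) 0 (zero_mem _)

theorem actinv_zero (g : G) : B.actinv g 0 = 0 := by
  simpa [B.act_zero] using B.actinv_act g 0 (zero_mem _)

theorem mul_mem_right (g : G) (a : T) {x : T} (hx : x ∈ B.D (gd.tgt g)) :
    x * a ∈ B.D (gd.tgt g) :=
  (B.ideal_top g a x hx).2

theorem mul_D_eq_of_isGlobal (hglobal : ∀ g, B.D g = B.D (gd.tgt g)) {g h : G}
    (hc : gd.comp g h) :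
    setMulAdd (B.D g : Set T) (B.D (gd.mul g h) : Set T) = B.D g := by
  rw [hglobal (gd.mul g h), gd.tgt_mul g h hc, ← hglobal g, B.sq]

theorem D_inv_of_isGlobal (hglobal : ∀ g, B.D g = B.D (gd.tgt g)) (g : G) :
    B.D (gd.inv g) = B.D (gd.src g) := by
  rw [hglobal, gd.tgt_inv]

theorem actinv_of_isId (hglobal : ∀ g, B.D g = B.D (gd.tgt g)) {e : G} (he : gd.isId e)
    {a : T} (ha : a ∈ B.D e) : B.actinv e a = a := by
  have h := B.actinv_act e a (by rwa [B.D_inv_of_isGlobal hglobal, gd.src_eq_of_isId he])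
  rwa [B.act_id e he a ha] at h

end RingTPA

section CrossedProduct

variable {G : Type u} {T : Type v} [NonUnitalRing T] (gd : PGroupoid G) (B : RingTPA gd T)

theorem sum_single_identity_apply {G0 : Finset G} (hG0 : ∀ e, e ∈ G0 ↔ gd.isId e) (one : G → T)
    (e : G) :
    (G0.sum fun e => Finsupp.single e (one e)) e = if gd.isId e then one e else 0 := by
  simp [Finsupp.finsetSum_apply, Finsupp.single_apply, hG0]

/-- Right multiplication by an element supported on the identities. -/
theorem cpMul_apply_of_right (f p : G →₀ T) (hp : ∀ e, p e ≠ 0 → gd.isId e) (g : G) :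
    cpMul gd B f p g =
      B.act g (B.actinv g (f g) * p (gd.src g)) * B.w g (gd.src g) := by
  have inner : ∀ k, (p.sum fun h b => if gd.comp k h then
      Finsupp.single (gd.mul k h) (B.act k (B.actinv k (f k) * b) * B.w k h) else 0) =
      Finsupp.single k (B.act k (B.actinv k (f k) * p (gd.src k)) * B.w k (gd.src k)) := by
    intro k
    rw [Finsupp.sum, Finset.sum_eq_single (gd.src k)]
    · rw [if_pos (gd.comp_src_self k), gd.mul_src_self]
    · intro e he hne
      refine if_neg fun hc => hne ?_
      rw [gd.comp_iff, hp e (Finsupp.mem_support_iff.1 he)] at hc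
      exact hc.symm
    · intro h
      simp [Finsupp.notMem_support_iff.1 h, B.act_zero]
  unfold cpMul
  rw [Finsupp.sum, Finset.sum_congr rfl fun k _ => inner k, Finsupp.finsetSum_apply,
    Finset.sum_eq_single g]
  · simp
  · intro k _ hk
    simp [hk]
  · intro h
    simp [Finsupp.notMem_support_iff.1 h, B.act_zero, B.actinv_zero]

/-- Left multiplication by an element supported on the identities. -/
theorem cpMul_apply_of_left (p f : G →₀ T) (hp : ∀ e, p e ≠ 0 → gd.isId e) (g : G) :
    cpMul gd B p f g =
      B.act (gd.tgt g) (B.actinv (gd.tgt g) (p (gd.tgt g)) * f g) * B.w (gd.tgt g) g := by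
  unfold cpMul
  rw [Finsupp.sum, Finsupp.finsetSum_apply, Finset.sum_eq_single (gd.tgt g)]
  · rw [Finsupp.sum, Finsupp.finsetSum_apply, Finset.sum_eq_single g]
    · simp [gd.comp_tgt_self, gd.tgt_mul_self]
    · intro h _ hne
      split_ifs with hc
      · have hm : gd.mul (gd.tgt g) h = h := by
          rw [gd.comp_iff, gd.src_tgt] at hc
          rw [hc, gd.tgt_mul_self]
        simp [hm, hne]
      · rfl
    · intro h
      simp [Finsupp.notMem_support_iff.1 h, B.act_zero]
  · intro e he hne
    have hid := hp e (Finsupp.mem_support_iff.1 he)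
    rw [Finsupp.sum, Finsupp.finsetSum_apply]
    refine Finset.sum_eq_zero fun h _ => ?_
    split_ifs with hc
    · have heq : e = gd.tgt h := by
        rwa [gd.comp_iff, gd.src_eq_of_isId hid] at hc
      have hm : gd.mul e h = h := by rw [heq, gd.tgt_mul_self]
      have : h ≠ g := fun hg => hne (by rw [heq, hg])
      simp [hm, this]
    · rfl
  · intro h
    rw [Finsupp.sum, Finsupp.finsetSum_apply]
    refine Finset.sum_eq_zero fun k _ => ?_
    simp [Finsupp.notMem_support_iff.1 h, B.act_zero, B.actinv_zero]

theorem cpMul_single_single {g h : G} (hc : gd.comp g h) (a b : T) :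
    cpMul gd B (Finsupp.single g a) (Finsupp.single h b) =
      Finsupp.single (gd.mul g h) (B.act g (B.actinv g a * b) * B.w g h) := by
  unfold cpMul
  rw [Finsupp.sum_single_index, Finsupp.sum_single_index]
  · rw [if_pos hc]
  · simp [B.act_zero]
  · simp [B.act_zero, B.actinv_zero]

variable {gd}

/-- The crossed product by a global action is closed under multiplication. -/
theorem cpMul_mem_of_isGlobal (hglobal : ∀ g, B.D g = B.D (gd.tgt g)) {f f' : G →₀ T}
    (hf : ∀ g, f g ∈ B.D g) (k : G) : cpMul gd B f f' k ∈ B.D k := by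
  unfold cpMul
  rw [Finsupp.sum, Finsupp.finsetSum_apply]
  refine sum_mem fun g _ => ?_
  rw [Finsupp.sum, Finsupp.finsetSum_apply]
  refine sum_mem fun h _ => ?_
  split_ifs with hc
  · rw [Finsupp.single_apply]
    split_ifs with hk
    · have hm : B.D k = B.D g := by rw [← hk, hglobal, gd.tgt_mul g h hc, ← hglobal]
      have hz : B.actinv g (f g) * f' h ∈ B.D (gd.inv g) := by
        have := B.actinv_mem g _ (hf g)
        rw [hglobal] at this ⊢
        exact B.mul_mem_right _ _ this
      have := (B.w_mul_mem g h hc (B.act g (B.actinv g (f g) * f' h))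
        (by rw [B.mul_D_eq_of_isGlobal hglobal hc]; exact B.act_mem g hz)).2
      rwa [B.mul_D_eq_of_isGlobal hglobal hc, ← hm] at this
    · exact zero_mem _
  · exact zero_mem _

end CrossedProduct

/-- Let `A` be a twisted partial action with each `D g` unital and `B`
(a twisted global action of `gd` on `T`) a globalization of it; identify `φ_e(D_e)` with
`D_e` (so the `A.D g` are ideals of `T`, `A.act` restricts `B.act` and `A.w` restricts `B.w`).
Assume the set `G0` of identities of `gd` is finite, and let `1_A = Σ_{e ∈ G0} 1_e δ_e`, an
identity of `A = R ⋊_{α,w} 𝒢 ⊆ B = T ⋊_{β,u} 𝒢`.  Then: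
(i)  `B·1_A  = { Σ c_g δ_g : c_g ∈ β_g(D_{d(g)}) }`;
(ii) `1_A·B  = { Σ c_g δ_g : c_g ∈ D_{r(g)} }`;
(iii) `1_A·B·1_A = A`;
(iv) `B·1_A·B = B`. -/
theorem statement2 {G : Type u} {T : Type v} [NonUnitalRing T]
    (gd : PGroupoid G) (B : RingTPA gd T)
    (hglobal : ∀ g, B.D g = B.D (gd.tgt g))
    (A : RingTPA gd T)
    (hsub : ∀ e, gd.isId e → A.D e ≤ B.D e)
    (hideal : ∀ e, gd.isId e → ∀ s ∈ B.D e, ∀ x ∈ A.D e, s * x ∈ A.D e ∧ x * s ∈ A.D e)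
    (hact : ∀ g, ∀ a ∈ A.D (gd.inv g), A.act g a = B.act g a)
    (hactinv : ∀ g, ∀ a ∈ A.D g, A.actinv g a = B.actinv g a)
    (hcap : ∀ g, (A.D g : Set T) =
        ((A.D (gd.tgt g) : Set T)) ∩ (B.act g '' ((A.D (gd.src g) : Set T))))
    (hsum : ∀ g, B.D g = AddSubgroup.closure
        (⋃ h ∈ {h : G | gd.tgt h = gd.tgt g}, B.act h '' ((A.D (gd.src h) : Set T))))
    (hw : ∀ g h, gd.comp g h →
        ∀ a ∈ setMulAdd ((A.D g : Set T)) ((A.D (gd.mul g h) : Set T)),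
        a * A.w g h = a * B.w g h ∧ A.w g h * a = B.w g h * a)
    (one : G → T) (hone_mem : ∀ g, one g ∈ A.D g)
    (hone : ∀ g, ∀ x ∈ A.D g, one g * x = x ∧ x * one g = x)
    (G0 : Finset G) (hG0 : ∀ e, e ∈ G0 ↔ gd.isId e)
    (oneA : G →₀ T) (honeA : oneA = G0.sum fun e => Finsupp.single e (one e))
 :
    ({x : G →₀ T | ∃ f : G →₀ T, (∀ g, f g ∈ B.D g) ∧ x = cpMul gd B f oneA} =
      {f : G →₀ T | ∀ g, f g ∈ B.act g '' ((A.D (gd.src g) : Set T))}) ∧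
    ({x : G →₀ T | ∃ f : G →₀ T, (∀ g, f g ∈ B.D g) ∧ x = cpMul gd B oneA f} =
      {f : G →₀ T | ∀ g, f g ∈ A.D (gd.tgt g)}) ∧
    ({x : G →₀ T | ∃ f : G →₀ T, (∀ g, f g ∈ B.D g) ∧
        x = cpMul gd B oneA (cpMul gd B f oneA)} =
      {f : G →₀ T | ∀ g, f g ∈ A.D g}) ∧
    (∀ x : G →₀ T,
      x ∈ AddSubgroup.closure {y : G →₀ T | ∃ f f' : G →₀ T,
          (∀ g, f g ∈ B.D g) ∧ (∀ g, f' g ∈ B.D g) ∧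
          y = cpMul gd B (cpMul gd B f oneA) f'} ↔
        (∀ g, x g ∈ B.D g)) := by
  have hp : ∀ e, oneA e ≠ 0 → gd.isId e := by
    intro e he
    by_contra hne
    rw [honeA, sum_single_identity_apply gd hG0, if_neg hne] at he
    exact he rfl
  have hoe : ∀ e, gd.isId e → oneA e = one e := by
    intro e he
    rw [honeA, sum_single_identity_apply gd hG0, if_pos he]
  have htgt : ∀ g, gd.isId (gd.tgt g) := gd.tgt_tgt
  have hsrc : ∀ g, gd.isId (gd.src g) := gd.tgt_src
  have hinv := B.D_inv_of_isGlobal hglobal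
  have hAinv : ∀ g, ∀ a ∈ A.D (gd.src g), a ∈ B.D (gd.inv g) := by
    intro g a ha
    rw [hinv]
    exact hsub _ (hsrc g) ha
  have hmem : ∀ g, ∀ a ∈ B.D g, B.actinv g a * one (gd.src g) ∈ A.D (gd.src g) := by
    intro g a ha
    refine (hideal _ (hsrc g) _ ?_ _ (hone_mem _)).1
    rw [← hinv]
    exact B.actinv_mem g a ha
  have right_apply : ∀ f : G →₀ T, (∀ g, f g ∈ B.D g) → ∀ g,
      cpMul gd B f oneA g = B.act g (B.actinv g (f g) * one (gd.src g)) := by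
    intro f hf g
    rw [cpMul_apply_of_right gd B f oneA hp, hoe _ (hsrc g)]
    exact (B.w_id_right g _ (B.act_mem g (hAinv g _ (hmem g _ (hf g))))).2
  have left_apply : ∀ f : G →₀ T, (∀ g, f g ∈ B.D g) → ∀ g,
      cpMul gd B oneA f g = one (gd.tgt g) * f g := by
    intro f hf g
    have h1 : one (gd.tgt g) ∈ B.D (gd.tgt g) := hsub _ (htgt g) (hone_mem _)
    have h2 : one (gd.tgt g) * f g ∈ B.D (gd.tgt g) := B.mul_mem_right _ _ h1
    rw [cpMul_apply_of_left gd B oneA f hp, hoe _ (htgt g),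
      B.actinv_of_isId hglobal (htgt g) h1, B.act_id _ (htgt g) _ h2]
    exact (B.w_id_left g _ (by rwa [hglobal])).2
  have act_mem_D : ∀ g, ∀ c ∈ B.act g '' (A.D (gd.src g) : Set T), c ∈ B.D g := by
    rintro g _ ⟨a, ha, rfl⟩
    exact B.act_mem g (hAinv g a ha)
  have right_fix : ∀ f : G →₀ T, (∀ g, f g ∈ B.act g '' (A.D (gd.src g) : Set T)) →
      cpMul gd B f oneA = f := by
    intro f hf
    ext g
    rw [right_apply f fun g => act_mem_D g _ (hf g)]
    obtain ⟨a, ha, hfa⟩ := hf g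
    rw [← hfa, B.actinv_act g a (hAinv g a ha), (hone _ a ha).2]
  have left_fix : ∀ f : G →₀ T, (∀ g, f g ∈ A.D (gd.tgt g)) → cpMul gd B oneA f = f := by
    intro f hf
    ext g
    rw [left_apply f fun g => by rw [hglobal]; exact hsub _ (htgt g) (hf g)]
    exact (hone _ _ (hf g)).1
  have right_mem : ∀ f : G →₀ T, (∀ g, f g ∈ B.D g) → ∀ g,
      cpMul gd B f oneA g ∈ B.act g '' (A.D (gd.src g) : Set T) := by
    intro f hf g
    rw [right_apply f hf]
    exact ⟨_, hmem g _ (hf g), rfl⟩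
  refine ⟨?_, ?_, ?_, ?_⟩
  · ext x
    constructor
    · rintro ⟨f, hf, rfl⟩
      exact right_mem f hf
    · intro hx
      exact ⟨x, fun g => act_mem_D g _ (hx g), (right_fix x hx).symm⟩
  · ext x
    constructor
    · rintro ⟨f, hf, rfl⟩ g
      rw [left_apply f hf]
      exact (hideal _ (htgt g) _ (by rw [← hglobal]; exact hf g) _ (hone_mem _)).2
    · intro hx
      exact ⟨x, fun g => by rw [hglobal]; exact hsub _ (htgt g) (hx g), (left_fix x hx).symm⟩
  · ext x
    constructor
    · rintro ⟨f, hf, rfl⟩ g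
      have hc := right_mem f hf
      have hcD : ∀ g, cpMul gd B f oneA g ∈ B.D g := fun g => act_mem_D g _ (hc g)
      rw [left_apply _ hcD, ← SetLike.mem_coe, hcap]
      refine ⟨(hideal _ (htgt g) _ (by rw [← hglobal]; exact hcD g) _ (hone_mem _)).2, ?_⟩
      obtain ⟨a, ha, hca⟩ := hc g
      have ho : one (gd.tgt g) ∈ B.D g := by
        rw [hglobal]
        exact hsub _ (htgt g) (hone_mem _)
      have hb := B.actinv_mem g _ ho
      refine ⟨B.actinv g (one (gd.tgt g)) * a,
        (hideal _ (hsrc g) _ (by rwa [← hinv]) _ ha).1, ?_⟩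
      rw [B.act_mul g _ hb _ (hAinv g a ha), B.act_actinv g _ ho, hca]
    · intro hx
      have hx' : ∀ g, x g ∈ (A.D (gd.tgt g) : Set T) ∩ B.act g '' (A.D (gd.src g) : Set T) := by
        intro g
        rw [← hcap]
        exact hx g
      refine ⟨x, fun g => act_mem_D g _ (hx' g).2, ?_⟩
      rw [right_fix x fun g => (hx' g).2, left_fix x fun g => (hx' g).1]
  · intro x
    constructor
    · intro hx
      induction hx using AddSubgroup.closure_induction with
      | mem y hy =>
        obtain ⟨f, f', hf, -, rfl⟩ := hy
        exact cpMul_mem_of_isGlobal B hglobal (cpMul_mem_of_isGlobal B hglobal hf)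
      | zero => exact fun g => zero_mem _
      | add y z _ _ hy hz => exact fun g => add_mem (hy g) (hz g)
      | neg y _ hy => exact fun g => neg_mem (hy g)
    · intro hx
      have hzero : ∀ (P : G → AddSubgroup T) {k : G} {c : T}, c ∈ P k → ∀ g,
          Finsupp.single k c g ∈ P g := by
        intro P k c hc g
        rw [Finsupp.single_apply]
        split_ifs with h
        · exact h ▸ hc
        · exact zero_mem _
      rw [← Finsupp.sum_single x]
      refine sum_mem fun g _ => ?_
      have hg := hx g
      rw [hsum] at hg
      generalize x g = c at hg ⊢
      induction hg using AddSubgroup.closure_induction with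
      | zero => rw [Finsupp.single_zero]; exact zero_mem _
      | add y z _ _ hy hz => rw [Finsupp.single_add]; exact add_mem hy hz
      | neg y _ hy => rw [Finsupp.single_neg]; exact neg_mem hy
      | mem c hc =>
        simp only [Set.mem_iUnion, Set.mem_ofPred_eq] at hc
        obtain ⟨h, hh, a, ha, rfl⟩ := hc
        have haB := hAinv h a ha
        have hcB := B.act_mem h haB
        have hcmp : gd.comp (gd.inv h) g := (gd.comp_iff _ _).2 (by rw [gd.src_inv, hh])
        set k := gd.mul (gd.inv h) g with hk
        have htk : gd.tgt k = gd.src h := by rw [hk, gd.tgt_mul _ _ hcmp, gd.tgt_inv]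
        have hhk : gd.comp h k := (gd.comp_iff _ _).2 htk.symm
        have hD := B.mul_D_eq_of_isGlobal hglobal hhk
        have ho := hAinv h _ (hone_mem (gd.src h))
        have hoB := B.act_mem h ho
        have hv : B.act h (one (gd.src h)) * B.winv h k ∈ B.D h := by
          have := (B.winv_mul_mem h k hhk _ (by rw [hD]; exact hoB)).2
          rwa [hD] at this
        have hb := B.actinv_mem h _ hv
        have hbk : B.actinv h (B.act h (one (gd.src h)) * B.winv h k) ∈ B.D k := by
          rwa [hglobal, htk, ← hinv]
        refine AddSubgroup.subset_closure ⟨Finsupp.single h (B.act h a), Finsupp.single k _,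
          hzero B.D hcB, hzero B.D hbk, ?_⟩
        have hfix : cpMul gd B (Finsupp.single h (B.act h a)) oneA =
            Finsupp.single h (B.act h a) := by
          refine right_fix _ fun g => ?_
          rw [Finsupp.single_apply]
          split_ifs with h'
          · subst h'
            exact ⟨a, ha, rfl⟩
          · exact ⟨0, zero_mem _, B.act_zero g⟩
        rw [hfix, cpMul_single_single gd B hhk, hk, gd.mul_inv_mul_cancel hh, ← hk,
          B.actinv_act h a haB, B.act_mul h a haB _ hb, B.act_actinv h _ hv, ← mul_assoc,
          ← B.act_mul h a haB _ ho, (hone _ a ha).2,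
          (B.w_winv h k hhk _ (by rw [hD]; exact hcB)).2.2.2]
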